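/- Let X be an integrable real-valued random variable on a probability space (Ω, 𝓕, ℙ) whose cumulative distribution function F_X is continuous on ℝ, and let α₁, α₂ satisfy 0 < α₁ ≤ α₂ < 1. Then CVaR_{α₁}(X) ≤ CVaR_{α₂}(X), i.e., the Conditional Value-at-Risk is nondecreasing in the confidence level α. -/

import Mathlib

open MeasureTheory

/-- Cumulative distribution function of a random variable `X` under measure `Pr`. -/
noncomputable def cdf {Ω : Type*} [MeasurableSpace Ω] (Pr : Measure Ω) (X : Ω → ℝ) (z : ℝ) : ℝ :=
  (Pr {ω | X ω ≤ z}).toReal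

/-- Value-at-Risk at confidence level `α`: `VaR_α(X) = sInf {z | F_X(z) ≥ α}`. -/
noncomputable def VaR {Ω : Type*} [MeasurableSpace Ω] (Pr : Measure Ω) (X : Ω → ℝ) (α : ℝ) : ℝ :=
  sInf {z : ℝ | α ≤ cdf Pr X z}

/-- Conditional Value-at-Risk: `CVaR_α(X) = E[X · 1_{X > VaR_α(X)}] / ℙ(X > VaR_α(X))`. -/
noncomputable def CVaR {Ω : Type*} [MeasurableSpace Ω] (Pr : Measure Ω) (X : Ω → ℝ) (α : ℝ) : ℝ :=
  (∫ ω in {ω | VaR Pr X α < X ω}, X ω ∂Pr) / (Pr {ω | VaR Pr X α < X ω}).toReal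

open Filter

section

variable {Ω : Type*} [MeasurableSpace Ω] {Pr : Measure Ω} {X : Ω → ℝ}

lemma cdf_eq_cdf_map [IsProbabilityMeasure Pr] (hX : AEMeasurable X Pr) :
    cdf Pr X = ProbabilityTheory.cdf (Pr.map X) := by
  have := Measure.isProbabilityMeasure_map hX
  ext z
  rw [ProbabilityTheory.cdf_eq_real, Measure.real,
    Measure.map_apply_of_aemeasurable hX measurableSet_Iic]
  rfl

lemma bddBelow_setOf_le_cdf [IsProbabilityMeasure Pr] (hX : AEMeasurable X Pr) {α : ℝ}
    (hα : 0 < α) : BddBelow {z : ℝ | α ≤ cdf Pr X z} := by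
  rw [cdf_eq_cdf_map hX]
  obtain ⟨b, hb⟩ := ((ProbabilityTheory.tendsto_cdf_atBot (Pr.map X)).eventually_lt_const hα).exists
  refine ⟨b, fun z (hz : α ≤ _) ↦ ?_⟩
  by_contra! hzb
  exact (hz.trans (ProbabilityTheory.monotone_cdf _ hzb.le)).not_gt hb

lemma nonempty_setOf_le_cdf [IsProbabilityMeasure Pr] (hX : AEMeasurable X Pr) {α : ℝ}
    (hα : α < 1) : {z : ℝ | α ≤ cdf Pr X z}.Nonempty := by
  rw [cdf_eq_cdf_map hX]
  obtain ⟨b, hb⟩ :=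
    ((ProbabilityTheory.tendsto_cdf_atTop (Pr.map X)).eventually_const_lt hα).exists
  exact ⟨b, hb.le⟩

lemma VaR_mono [IsProbabilityMeasure Pr] (hX : AEMeasurable X Pr) {α β : ℝ}
    (hα : 0 < α) (hαβ : α ≤ β) (hβ : β < 1) : VaR Pr X α ≤ VaR Pr X β :=
  csInf_le_csInf (bddBelow_setOf_le_cdf hX hα) (nonempty_setOf_le_cdf hX hβ)
    fun _ hz ↦ hαβ.trans hz

lemma cdf_VaR_le [IsProbabilityMeasure Pr] (hX : AEMeasurable X Pr)
    (hcont : Continuous (cdf Pr X)) {α : ℝ} (hα : 0 < α) : cdf Pr X (VaR Pr X α) ≤ α := by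
  refine le_of_tendsto (hcont.continuousWithinAt (s := Set.Iio (VaR Pr X α))) ?_
  filter_upwards [self_mem_nhdsWithin] with z hz
  exact (not_le.1 fun h ↦ notMem_of_lt_csInf hz (bddBelow_setOf_le_cdf hX hα) h).le

lemma nullMeasurableSet_setOf_const_lt (hX : AEMeasurable X Pr) (v : ℝ) :
    NullMeasurableSet {ω | v < X ω} Pr :=
  hX.nullMeasurableSet_preimage measurableSet_Ioi

lemma measureReal_lt_pos_of_cdf_lt_one [IsProbabilityMeasure Pr] (hX : AEMeasurable X Pr) {v : ℝ}
    (hv : cdf Pr X v < 1) : 0 < Pr.real {ω | v < X ω} := by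
  have h := probReal_compl_eq_one_sub₀ (nullMeasurableSet_setOf_const_lt hX v)
  have hc : {ω | v < X ω}ᶜ = {ω | X ω ≤ v} := by ext; simp
  rw [hc] at h
  have : Pr.real {ω | X ω ≤ v} < 1 := hv
  linarith

lemma setIntegral_div_measureReal_tail_mono [IsFiniteMeasure Pr] (hint : Integrable X Pr)
    {v w : ℝ} (hvw : v ≤ w) (hw : 0 < Pr.real {ω | w < X ω}) :
    (∫ ω in {ω | v < X ω}, X ω ∂Pr) / Pr.real {ω | v < X ω} ≤
      (∫ ω in {ω | w < X ω}, X ω ∂Pr) / Pr.real {ω | w < X ω} := by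
  have hA := nullMeasurableSet_setOf_const_lt hint.aemeasurable v
  have hB := nullMeasurableSet_setOf_const_lt hint.aemeasurable w
  set A := {ω | v < X ω}
  set B := {ω | w < X ω}
  have hBA : B ⊆ A := fun ω hω ↦ hvw.trans_lt hω
  have hI : ∫ ω in A, X ω ∂Pr = ∫ ω in B, X ω ∂Pr + ∫ ω in A \ B, X ω ∂Pr := by
    rw [← integral_inter_add_sdiff₀ hB hint.integrableOn, Set.inter_eq_self_of_subset_right hBA]
  have hP : Pr.real A = Pr.real B + Pr.real (A \ B) := by
    rw [← measureReal_inter_add_sdiff₀ (s := A) hB, Set.inter_eq_self_of_subset_right hBA]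
  have hlow : w * Pr.real B ≤ ∫ ω in B, X ω ∂Pr := by
    have h : ∫ _ in B, w ∂Pr ≤ ∫ ω in B, X ω ∂Pr :=
      integral_mono_ae (integrable_const _) hint.integrableOn
        ((ae_restrict_mem₀ hB).mono fun _ hω ↦ le_of_lt hω)
    simpa [mul_comm] using h
  have hup : ∫ ω in A \ B, X ω ∂Pr ≤ w * Pr.real (A \ B) := by
    have h : ∫ ω in A \ B, X ω ∂Pr ≤ ∫ _ in A \ B, w ∂Pr :=
      integral_mono_ae hint.integrableOn (integrable_const _)
        ((ae_restrict_mem₀ (hA.diff hB)).mono fun _ hω ↦ not_lt.1 hω.2)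
    simpa [mul_comm] using h
  have hD : 0 ≤ Pr.real (A \ B) := measureReal_nonneg
  rw [div_le_div_iff₀ (by linarith) hw, hI, hP]
  nlinarith [mul_le_mul_of_nonneg_right hup hw.le, mul_le_mul_of_nonneg_right hlow hD]

end

/-- For an integrable `X` with continuous cdf, CVaR is nondecreasing in the
confidence level: `0 < α₁ ≤ α₂ < 1` implies `CVaR_{α₁}(X) ≤ CVaR_{α₂}(X)`. -/
theorem CVaR_mono_in_alpha {Ω : Type*} [MeasurableSpace Ω]
    (Pr : Measure Ω) [IsProbabilityMeasure Pr] (X : Ω → ℝ)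
    (hint : Integrable X Pr) (hcont : Continuous (cdf Pr X))
    (α₁ α₂ : ℝ) (h1 : 0 < α₁) (h12 : α₁ ≤ α₂) (h2 : α₂ < 1) :
    CVaR Pr X α₁ ≤ CVaR Pr X α₂ := by
  have hX := hint.aemeasurable
  exact setIntegral_div_measureReal_tail_mono hint (VaR_mono hX h1 h12 h2)
    (measureReal_lt_pos_of_cdf_lt_one hX
      ((cdf_VaR_le hX hcont (h1.trans_le h12)).trans_lt h2))
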